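/- The energy-momentum tensor T_{μν} = μ l_μ l_ν + (ρ+ϱ)(l_μ n_ν + l_ν n_μ) + ϱ g_{μν}, with μ = 2ṁ/r², ρ = 2m'/r², ϱ = -m''/r, l_μ = δ⁰_μ and n_μ = ½(1 - 2m/r)δ⁰_μ - δ¹_μ, satisfies the Einstein equations G_{μν} = T_{μν} for the generalised Vaidya metric; in particular l and n are null with l_μ n^μ = -1. -/

import Mathlib

noncomputable section

/-- Spacetime points in coordinates `(v, r, θ, φ)`. -/
abbrev Pt : Type := Fin 4 → ℝ

/-- Partial derivative of a scalar field in the `i`-th coordinate direction. -/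
def pd (i : Fin 4) (f : Pt → ℝ) (x : Pt) : ℝ :=
  fderiv ℝ f x (Pi.single i 1)

/-- The generalised Vaidya metric components `g_{ab}` for
`ds² = -(1 - 2m(v,r)/r) dv² + 2 dv dr + r² (dθ² + sin²θ dφ²)`. -/
def gV (m : ℝ → ℝ → ℝ) : Fin 4 → Fin 4 → Pt → ℝ := fun a b x =>
  if a = 0 ∧ b = 0 then -(1 - 2 * m (x 0) (x 1) / x 1)
  else if (a = 0 ∧ b = 1) ∨ (a = 1 ∧ b = 0) then 1
  else if a = 2 ∧ b = 2 then (x 1) ^ 2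
  else if a = 3 ∧ b = 3 then (x 1) ^ 2 * Real.sin (x 2) ^ 2
  else 0

/-- The inverse metric components `g^{ab}` of the generalised Vaidya metric. -/
def gVInv (m : ℝ → ℝ → ℝ) : Fin 4 → Fin 4 → Pt → ℝ := fun a b x =>
  if (a = 0 ∧ b = 1) ∨ (a = 1 ∧ b = 0) then 1
  else if a = 1 ∧ b = 1 then 1 - 2 * m (x 0) (x 1) / x 1
  else if a = 2 ∧ b = 2 then 1 / (x 1) ^ 2
  else if a = 3 ∧ b = 3 then 1 / ((x 1) ^ 2 * Real.sin (x 2) ^ 2)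
  else 0

/-- Christoffel symbols `Γ^a_{bd} = ½ g^{ae}(g_{be,d} + g_{ed,b} - g_{bd,e})`. -/
def chr (m : ℝ → ℝ → ℝ) (a b d : Fin 4) (x : Pt) : ℝ :=
  (1 / 2) * ∑ e, gVInv m a e x *
    (pd d (gV m b e) x + pd b (gV m e d) x - pd e (gV m b d) x)

/-- Riemann tensor `R^a_{bcd} = Γ^a_{bd,c} - Γ^a_{bc,d} + Γ^e_{bd}Γ^a_{ce} - Γ^e_{bc}Γ^a_{de}`. -/
def riem (m : ℝ → ℝ → ℝ) (a b c d : Fin 4) (x : Pt) : ℝ :=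
  pd c (chr m a b d) x - pd d (chr m a b c) x
    + ∑ e, chr m e b d x * chr m a c e x - ∑ e, chr m e b c x * chr m a d e x

/-- Ricci tensor `R_{bd} = R^c_{bcd}` (contraction of first and third indices). -/
def ric (m : ℝ → ℝ → ℝ) (b d : Fin 4) (x : Pt) : ℝ :=
  ∑ c, riem m c b c d x

/-- Mixed Ricci tensor `R^a_b = g^{ac} R_{cb}`. -/
def ricM (m : ℝ → ℝ → ℝ) (a b : Fin 4) (x : Pt) : ℝ :=
  ∑ c, gVInv m a c x * ric m c b x

/-- Ricci scalar `R = R^a_a`. -/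
def ricS (m : ℝ → ℝ → ℝ) (x : Pt) : ℝ := ∑ a, ricM m a a x

/-- The null covector `l_μ = δ⁰_μ`. -/
def lLow : Fin 4 → ℝ := fun a => if a = 0 then 1 else 0

/-- The null covector `n_μ = ½(1 - 2m/r)δ⁰_μ - δ¹_μ`. -/
def nLow (m : ℝ → ℝ → ℝ) (x : Pt) : Fin 4 → ℝ := fun a =>
  if a = 0 then (1 / 2) * (1 - 2 * m (x 0) (x 1) / x 1)
  else if a = 1 then -1 else 0

/-- The generalised Vaidya energy-momentum tensor
`T_{μν} = μ l_μ l_ν + (ρ+ϱ)(l_μ n_ν + l_ν n_μ) + ϱ g_{μν}`. -/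
def Tlow (m : ℝ → ℝ → ℝ) (a b : Fin 4) (x : Pt) : ℝ :=
  let μ := 2 * deriv (fun s => m s (x 1)) (x 0) / (x 1) ^ 2
  let ρ := 2 * deriv (fun s => m (x 0) s) (x 1) / (x 1) ^ 2
  let ϱ := -(deriv (deriv (fun s => m (x 0) s)) (x 1)) / x 1
  μ * lLow a * lLow b + (ρ + ϱ) * (lLow a * nLow m x b + lLow b * nLow m x a)
    + ϱ * gV m a b x

/-- Lowered Einstein tensor `G_{ab} = R_{ab} - ½ R g_{ab}`. -/
def einLow (m : ℝ → ℝ → ℝ) (a b : Fin 4) (x : Pt) : ℝ :=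
  ric m a b x - (1 / 2) * ricS m x * gV m a b x

/-- `f` is differentiable at `x` and its coordinate partial derivatives there are `g`. -/
def HasPD (f : Pt → ℝ) (x : Pt) (g : Fin 4 → ℝ) : Prop :=
  DifferentiableAt ℝ f x ∧ ∀ i, pd i f x = g i

namespace HasPD

variable {f g : Pt → ℝ} {x : Pt} {f' g' : Fin 4 → ℝ}

theorem congr_deriv (hf : HasPD f x f') (h : f' = g') : HasPD f x g' := h ▸ hf

theorem congr_of_eventuallyEq (hf : HasPD f x f') (h : g =ᶠ[nhds x] f) : HasPD g x f' :=
  ⟨hf.1.congr_of_eventuallyEq h, fun i => by rw [← hf.2 i, pd, pd, h.fderiv_eq]⟩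

theorem of_hasFDerivAt {L : Pt →L[ℝ] ℝ} (h : HasFDerivAt f L x) :
    HasPD f x (fun i => L (Pi.single i 1)) :=
  ⟨h.differentiableAt, fun i => by rw [pd, h.fderiv]⟩

theorem const (c : ℝ) : HasPD (fun _ => c) x 0 :=
  of_hasFDerivAt (hasFDerivAt_const c x)

theorem coord (j : Fin 4) : HasPD (fun y => y j) x (Pi.single j 1) := by
  refine (of_hasFDerivAt (hasFDerivAt_apply j x)).congr_deriv (funext fun i => ?_)
  simp [Pi.single_apply, eq_comm]

theorem neg (hf : HasPD f x f') : HasPD (fun y => -f y) x (fun i => -f' i) := by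
  refine (of_hasFDerivAt hf.1.hasFDerivAt.fun_neg).congr_deriv (funext fun i => ?_)
  simp [← hf.2 i, pd]

theorem add (hf : HasPD f x f') (hg : HasPD g x g') :
    HasPD (fun y => f y + g y) x (fun i => f' i + g' i) := by
  refine (of_hasFDerivAt (hf.1.hasFDerivAt.fun_add hg.1.hasFDerivAt)).congr_deriv
    (funext fun i => ?_)
  simp [← hf.2 i, ← hg.2 i, pd]

theorem sub (hf : HasPD f x f') (hg : HasPD g x g') :
    HasPD (fun y => f y - g y) x (fun i => f' i - g' i) := by
  simpa only [sub_eq_add_neg] using hf.add hg.neg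

theorem mul (hf : HasPD f x f') (hg : HasPD g x g') :
    HasPD (fun y => f y * g y) x (fun i => f' i * g x + f x * g' i) := by
  refine (of_hasFDerivAt (hf.1.hasFDerivAt.fun_mul hg.1.hasFDerivAt)).congr_deriv
    (funext fun i => ?_)
  simp [← hf.2 i, ← hg.2 i, pd]
  ring

theorem comp {u : ℝ → ℝ} {u' : ℝ} (hu : HasDerivAt u u' (f x)) (hf : HasPD f x f') :
    HasPD (fun y => u (f y)) x (fun i => u' * f' i) := by
  refine (of_hasFDerivAt (hu.comp_hasFDerivAt x hf.1.hasFDerivAt)).congr_deriv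
    (funext fun i => ?_)
  simp [← hf.2 i, pd]

theorem div (hf : HasPD f x f') (hg : HasPD g x g') (h : g x ≠ 0) :
    HasPD (fun y => f y / g y) x (fun i => (f' i * g x - f x * g' i) / g x ^ 2) := by
  have := hf.mul (comp (hasDerivAt_inv h) hg)
  simp only [← div_eq_mul_inv] at this
  refine this.congr_deriv (funext fun i => ?_)
  field_simp
  ring

end HasPD

/-- Partial derivative in the first argument. -/
def derivFst (F : ℝ → ℝ → ℝ) (v r : ℝ) : ℝ := deriv (fun s => F s r) v

/-- Partial derivative in the second argument. -/
def derivSnd (F : ℝ → ℝ → ℝ) (v r : ℝ) : ℝ := deriv (fun s => F v s) r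

section TwoVariables

variable {F : ℝ → ℝ → ℝ}

theorem derivFst_eq_fderiv (hF : Differentiable ℝ (fun p : ℝ × ℝ => F p.1 p.2)) (p : ℝ × ℝ) :
    derivFst F p.1 p.2 = fderiv ℝ (fun p : ℝ × ℝ => F p.1 p.2) p (1, 0) :=
  (HasFDerivAt.comp_hasDerivAt (f := fun s => (s, p.2)) p.1 (hF p).hasFDerivAt
    ((hasDerivAt_id p.1).prodMk (hasDerivAt_const p.1 p.2))).deriv

theorem derivSnd_eq_fderiv (hF : Differentiable ℝ (fun p : ℝ × ℝ => F p.1 p.2)) (p : ℝ × ℝ) :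
    derivSnd F p.1 p.2 = fderiv ℝ (fun p : ℝ × ℝ => F p.1 p.2) p (0, 1) :=
  (HasFDerivAt.comp_hasDerivAt (f := fun s => (p.1, s)) p.2 (hF p).hasFDerivAt
    ((hasDerivAt_const p.2 p.1).prodMk (hasDerivAt_id p.2))).deriv

theorem contDiff_derivFst (hF : ContDiff ℝ 2 (fun p : ℝ × ℝ => F p.1 p.2)) :
    ContDiff ℝ 1 (fun p : ℝ × ℝ => derivFst F p.1 p.2) := by
  simp only [derivFst_eq_fderiv (hF.differentiable two_ne_zero)]
  exact (hF.fderiv_right (m := 1) (by norm_num)).clm_apply contDiff_const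

theorem contDiff_derivSnd (hF : ContDiff ℝ 2 (fun p : ℝ × ℝ => F p.1 p.2)) :
    ContDiff ℝ 1 (fun p : ℝ × ℝ => derivSnd F p.1 p.2) := by
  simp only [derivSnd_eq_fderiv (hF.differentiable two_ne_zero)]
  exact (hF.fderiv_right (m := 1) (by norm_num)).clm_apply contDiff_const

theorem derivFst_derivSnd (hF : ContDiff ℝ 2 (fun p : ℝ × ℝ => F p.1 p.2)) (v r : ℝ) :
    derivFst (derivSnd F) v r = derivSnd (derivFst F) v r := by
  have hd : DifferentiableAt ℝ (fderiv ℝ (fun p : ℝ × ℝ => F p.1 p.2)) (v, r) :=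
    (hF.fderiv_right (m := 1) (by norm_num)).differentiable one_ne_zero _
  have hs : IsSymmSndFDerivAt ℝ (fun p : ℝ × ℝ => F p.1 p.2) (v, r) :=
    hF.contDiffAt.isSymmSndFDerivAt (by simp)
  rw [derivFst_eq_fderiv ((contDiff_derivSnd hF).differentiable one_ne_zero) (v, r),
    derivSnd_eq_fderiv ((contDiff_derivFst hF).differentiable one_ne_zero) (v, r)]
  simp only [derivFst_eq_fderiv (hF.differentiable two_ne_zero),
    derivSnd_eq_fderiv (hF.differentiable two_ne_zero)]
  rw [fderiv_clm_apply hd (differentiableAt_const _), fderiv_clm_apply hd (differentiableAt_const _)]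
  simpa using hs.eq (1, 0) (0, 1)

theorem HasPD.fun_fst_snd (hF : Differentiable ℝ (fun p : ℝ × ℝ => F p.1 p.2)) (x : Pt) :
    HasPD (fun y => F (y 0) (y 1)) x
      ![derivFst F (x 0) (x 1), derivSnd F (x 0) (x 1), 0, 0] := by
  have h := (hF (x 0, x 1)).hasFDerivAt.comp x
    ((hasFDerivAt_apply (𝕜 := ℝ) (0 : Fin 4) x).prodMk (hasFDerivAt_apply (1 : Fin 4) x))
  refine (HasPD.of_hasFDerivAt h).congr_deriv (funext fun i => ?_)
  rw [derivFst_eq_fderiv hF (x 0, x 1), derivSnd_eq_fderiv hF (x 0, x 1)]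
  fin_cases i <;> simp [Prod.mk_zero_zero]

end TwoVariables

/-- Coordinate partial derivatives of the metric components; the last index is the direction of
differentiation. -/
def gVPartial (m : ℝ → ℝ → ℝ) (x : Pt) : Fin 4 → Fin 4 → Fin 4 → ℝ :=
  ![![![2 * derivFst m (x 0) (x 1) / x 1,
        2 * derivSnd m (x 0) (x 1) / x 1 - 2 * m (x 0) (x 1) / x 1 ^ 2, 0, 0], 0, 0, 0],
    ![0, 0, 0, 0],
    ![0, 0, ![0, 2 * x 1, 0, 0], 0],
    ![0, 0, 0, ![0, 2 * x 1 * Real.sin (x 2) ^ 2,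
      2 * x 1 ^ 2 * Real.sin (x 2) * Real.cos (x 2), 0]]]

theorem hasPD_gV {m : ℝ → ℝ → ℝ} (hm : Differentiable ℝ (fun p : ℝ × ℝ => m p.1 p.2))
    {x : Pt} (hr : x 1 ≠ 0) (a b : Fin 4) : HasPD (gV m a b) x (gVPartial m x a b) := by
  have hM := HasPD.fun_fst_snd hm x
  have h1 : HasPD (fun y => y 1) x _ := HasPD.coord 1
  have hs := HasPD.comp (Real.hasDerivAt_sin (x 2)) (HasPD.coord 2)
  have h00 := ((HasPD.const 1).sub (((HasPD.const 2).mul hM).div h1 hr)).neg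
  have h22 := h1.mul h1
  have h33 := h22.mul (hs.mul hs)
  simp only [← pow_two] at h22 h33
  fin_cases a <;> fin_cases b <;> simp [gVPartial] <;>
  first
  | exact HasPD.const _
  | (first
      | refine h00.congr_deriv ?_
      | refine h22.congr_deriv ?_
      | refine h33.congr_deriv ?_)
    ext i
    fin_cases i <;> simp [-mul_eq_mul_right_iff] <;> field_simp <;> ring

/-- Closed form of the Christoffel symbols `Γ^a_{bd}`. -/
def chrClosed (m : ℝ → ℝ → ℝ) (x : Pt) : Fin 4 → Fin 4 → Fin 4 → ℝ :=
  let r := x 1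
  let s := Real.sin (x 2)
  let c := Real.cos (x 2)
  let M := m (x 0) r
  let h := M / (r * r) - derivSnd m (x 0) r / r
  ![![![h, 0, 0, 0], ![0, 0, 0, 0], ![0, 0, -r, 0], ![0, 0, 0, -(r * (s * s))]],
    ![![derivFst m (x 0) r / r + (1 - 2 * M / r) * h, -h, 0, 0], ![-h, 0, 0, 0],
      ![0, 0, 2 * M - r, 0], ![0, 0, 0, (2 * M - r) * (s * s)]],
    ![![0, 0, 0, 0], ![0, 0, 1 / r, 0], ![0, 1 / r, 0, 0], ![0, 0, 0, -(s * c)]],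
    ![![0, 0, 0, 0], ![0, 0, 0, 1 / r], ![0, 0, 0, c / s], ![0, 1 / r, c / s, 0]]]

theorem chr_eq_chrClosed {m : ℝ → ℝ → ℝ} (hm : Differentiable ℝ (fun p : ℝ × ℝ => m p.1 p.2))
    {x : Pt} (hr : x 1 ≠ 0) (hθ : Real.sin (x 2) ≠ 0) (a b d : Fin 4) :
    chr m a b d x = chrClosed m x a b d := by
  simp only [chr, (hasPD_gV hm hr _ _).2, Fin.sum_univ_four]
  fin_cases a <;> fin_cases b <;> fin_cases d <;>
    simp [gVInv, gVPartial, chrClosed] <;> field_simp <;> ring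

/-- Coordinate partial derivatives of the Christoffel symbols; the last index is the direction of
differentiation. -/
def chrPartial (m : ℝ → ℝ → ℝ) (x : Pt) : Fin 4 → Fin 4 → Fin 4 → Fin 4 → ℝ :=
  let r := x 1
  let s := Real.sin (x 2)
  let c := Real.cos (x 2)
  let M := m (x 0) r
  let Mv := derivFst m (x 0) r
  let Mr := derivSnd m (x 0) r
  let Mvv := derivFst (derivFst m) (x 0) r
  let Mvr := derivSnd (derivFst m) (x 0) r
  let Mrr := derivSnd (derivSnd m) (x 0) r
  let h := M / r ^ 2 - Mr / r
  let hv := Mv / r ^ 2 - Mvr / r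
  let hr := 2 * Mr / r ^ 2 - 2 * M / r ^ 3 - Mrr / r
  ![![![![hv, hr, 0, 0], 0, 0, 0], 0, ![0, 0, ![0, -1, 0, 0], 0],
      ![0, 0, 0, ![0, -s ^ 2, -(2 * r * s * c), 0]]],
    ![![![Mvv / r - 2 * Mv / r * h + (1 - 2 * M / r) * hv,
          Mvr / r - Mv / r ^ 2 + 2 * h ^ 2 + (1 - 2 * M / r) * hr, 0, 0],
        ![-hv, -hr, 0, 0], 0, 0],
      ![![-hv, -hr, 0, 0], 0, 0, 0],
      ![0, 0, ![2 * Mv, 2 * Mr - 1, 0, 0], 0],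
      ![0, 0, 0, ![2 * Mv * s ^ 2, (2 * Mr - 1) * s ^ 2, 2 * (2 * M - r) * s * c, 0]]],
    ![0, ![0, 0, ![0, -1 / r ^ 2, 0, 0], 0], ![0, ![0, -1 / r ^ 2, 0, 0], 0, 0],
      ![0, 0, 0, ![0, 0, s ^ 2 - c ^ 2, 0]]],
    ![0, ![0, 0, 0, ![0, -1 / r ^ 2, 0, 0]], ![0, 0, 0, ![0, 0, -1 / s ^ 2, 0]],
      ![0, ![0, -1 / r ^ 2, 0, 0], ![0, 0, -1 / s ^ 2, 0], 0]]]

theorem hasPD_chr {m : ℝ → ℝ → ℝ} (hm : ContDiff ℝ 2 (fun p : ℝ × ℝ => m p.1 p.2))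
    {x : Pt} (hr : x 1 ≠ 0) (hθ : Real.sin (x 2) ≠ 0) (a b d : Fin 4) :
    HasPD (chr m a b d) x (chrPartial m x a b d) := by
  have heq : chr m a b d =ᶠ[nhds x] fun y => chrClosed m y a b d := by
    have h1 : ∀ᶠ y : Pt in nhds x, y 1 ≠ 0 := (continuous_apply 1).continuousAt.eventually_ne hr
    have h2 : ∀ᶠ y : Pt in nhds x, Real.sin (y 2) ≠ 0 :=
      (Real.continuous_sin.comp (continuous_apply 2)).continuousAt.eventually_ne hθ
    filter_upwards [h1, h2] with y hy1 hy2
    exact chr_eq_chrClosed (hm.differentiable two_ne_zero) hy1 hy2 a b d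
  refine HasPD.congr_of_eventuallyEq ?_ heq
  have hM := HasPD.fun_fst_snd (hm.differentiable two_ne_zero) x
  have hMv := HasPD.fun_fst_snd ((contDiff_derivFst hm).differentiable one_ne_zero) x
  have hMr := HasPD.fun_fst_snd ((contDiff_derivSnd hm).differentiable one_ne_zero) x
  rw [derivFst_derivSnd hm] at hMr
  have h1 : HasPD (fun y => y 1) x _ := HasPD.coord 1
  have hs := HasPD.comp (Real.hasDerivAt_sin (x 2)) (HasPD.coord 2)
  have hc := HasPD.comp (Real.hasDerivAt_cos (x 2)) (HasPD.coord 2)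
  have hh := (hM.div (h1.mul h1) (mul_ne_zero hr hr)).sub (hMr.div h1 hr)
  have h2M := (HasPD.const 2).mul hM
  have h100 := (hMv.div h1 hr).add (((HasPD.const 1).sub (h2M.div h1 hr)).mul hh)
  have h122 := h2M.sub h1
  have h133 := h122.mul (hs.mul hs)
  have h033 := (h1.mul (hs.mul hs)).neg
  have hinv := (HasPD.const 1).div h1 hr
  have h233 := (hs.mul hc).neg
  have hcot := hc.div hs hθ
  fin_cases a <;> fin_cases b <;> fin_cases d <;>
  first
  | exact HasPD.const 0
  | (first
      | refine hh.congr_deriv ?_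
      | refine hh.neg.congr_deriv ?_
      | refine h1.neg.congr_deriv ?_
      | refine h033.congr_deriv ?_
      | refine h100.congr_deriv ?_
      | refine h122.congr_deriv ?_
      | refine h133.congr_deriv ?_
      | refine hinv.congr_deriv ?_
      | refine h233.congr_deriv ?_
      | refine hcot.congr_deriv ?_)
    ext i
    fin_cases i <;> simp [chrPartial, -mul_eq_mul_right_iff, -mul_eq_mul_left_iff] <;> field_simp <;>
      (try rw [Real.cos_sq']) <;> ring

/-- Closed form of the Ricci tensor. -/
def ricClosed (m : ℝ → ℝ → ℝ) (x : Pt) : Fin 4 → Fin 4 → ℝ :=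
  let r := x 1
  let M := m (x 0) r
  let Mv := derivFst m (x 0) r
  let Mr := derivSnd m (x 0) r
  let Mrr := derivSnd (derivSnd m) (x 0) r
  ![![2 * Mv / r ^ 2 - (1 - 2 * M / r) * Mrr / r, Mrr / r, 0, 0],
    ![Mrr / r, 0, 0, 0],
    ![0, 0, 2 * Mr, 0],
    ![0, 0, 0, 2 * Mr * Real.sin (x 2) ^ 2]]

theorem ric_eq_ricClosed {m : ℝ → ℝ → ℝ} (hm : ContDiff ℝ 2 (fun p : ℝ × ℝ => m p.1 p.2))
    {x : Pt} (hr : x 1 ≠ 0) (hθ : Real.sin (x 2) ≠ 0) (b d : Fin 4) :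
    ric m b d x = ricClosed m x b d := by
  have hc : Real.cos (x 2) ^ 2 = 1 - Real.sin (x 2) ^ 2 := Real.cos_sq' _
  simp only [ric, riem, (hasPD_chr hm hr hθ _ _ _).2,
    chr_eq_chrClosed (hm.differentiable two_ne_zero) hr hθ, Fin.sum_univ_four]
  fin_cases b <;> fin_cases d <;> simp [chrPartial, chrClosed, ricClosed] <;>
    field_simp <;> (try rw [hc]) <;> ring

/-- The energy-momentum tensor `T_{μν} = μ l_μ l_ν + (ρ+ϱ)(l_μ n_ν + l_ν n_μ) + ϱ g_{μν}`,
with `μ = 2ṁ/r²`, `ρ = 2m'/r²`, `ϱ = -m''/r`, satisfies the Einstein equations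
`G_{μν} = T_{μν}` for the generalised Vaidya metric; in particular `l` and `n` are null
with `l_μ n^μ = -1`. -/
theorem generalised_vaidya_einstein_equations (m : ℝ → ℝ → ℝ)
    (hm : ContDiff ℝ 2 (fun p : ℝ × ℝ => m p.1 p.2))
    (x : Pt) (hr : x 1 ≠ 0) (hθ : Real.sin (x 2) ≠ 0) :
    (∀ a b : Fin 4, einLow m a b x = Tlow m a b x) ∧
    (∑ a, ∑ b, gVInv m a b x * lLow a * lLow b) = 0 ∧
    (∑ a, ∑ b, gVInv m a b x * nLow m x a * nLow m x b) = 0 ∧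
    (∑ a, ∑ b, gVInv m a b x * lLow a * nLow m x b) = -1 := by
  have hric := ric_eq_ricClosed hm hr hθ
  refine ⟨fun a b => ?_, ?_, ?_, ?_⟩
  · have h1 : deriv (fun s => m s (x 1)) (x 0) = derivFst m (x 0) (x 1) := rfl
    have h2 : deriv (fun s => m (x 0) s) (x 1) = derivSnd m (x 0) (x 1) := rfl
    have h3 : deriv (deriv (fun s => m (x 0) s)) (x 1) = derivSnd (derivSnd m) (x 0) (x 1) := rfl
    simp only [einLow, ricS, ricM, hric, Fin.sum_univ_four, Tlow, h1, h2, h3]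
    fin_cases a <;> fin_cases b <;> simp [ricClosed, gV, gVInv, lLow, nLow] <;>
      field_simp <;> ring
  · simp [gVInv, lLow]
  · simp [Fin.sum_univ_four, gVInv, nLow]
    ring
  · simp [Fin.sum_univ_four, gVInv, lLow, nLow]
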